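/- arXiv:1310.1860 — 3 statements merged into one kernel-verified Lean document; each statement's English description precedes it below -/
import Mathlib

section
/- Let G ⊆ G' be an inclusion of finite simple graphs, both of which are (2,2)-tight. Then there exists a finite sequence of simple graphs G = G₁, G₂, …, G_n = G' such that for each k, G_{k+1} is obtained from G_k by one of the following moves: a Henneberg vertex extension move of degree 2, a Henneberg edge move of degree 2, a vertex-to-K₄ move, or a vertex-to-4-cycle move. -/
open Asymptotics Filter Topology Set

open scoped Classical

noncomputable section

namespace RigidityPaper

variable {V X E : Type}

/-- `p` is a placement of the graph `G`: adjacent vertices are placed at distinct points. -/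
def IsPlacement (G : SimpleGraph V) (p : V → X) : Prop :=
  ∀ ⦃v w⦄, G.Adj v w → p v ≠ p w

section NormedSpace

variable [NormedAddCommGroup X] [NormedSpace ℝ X]

/-- `u` is an infinitesimal flex of the framework `(G,p)` in the normed space `X`. -/
def IsFlex (G : SimpleGraph V) (p u : V → X) : Prop :=
  ∀ ⦃v w⦄, G.Adj v w →
    (fun t : ℝ => ‖(p v + t • u v) - (p w + t • u w)‖ - ‖p v - p w‖)
      =o[𝓝 (0 : ℝ)] (fun t : ℝ => t)

/-- A continuous rigid motion of the normed space `X`. -/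
def IsContRigidMotion (Γ : X → ℝ → X) : Prop :=
  (∀ t ∈ Icc (-1 : ℝ) 1, Isometry (fun x => Γ x t)) ∧
    (∀ x, ContinuousOn (Γ x) (Icc (-1 : ℝ) 1)) ∧ ∀ x, Γ x 0 = x

/-- An infinitesimal rigid motion of the normed space `X`. -/
def IsInfRigidMotion (γ : X → X) : Prop :=
  ∃ Γ, IsContRigidMotion Γ ∧ ∀ x, HasDerivWithinAt (Γ x) (γ x) (Icc (-1 : ℝ) 1) 0

/-- `u` is a trivial (infinitesimal) flex on the vertex set `S`. -/
def IsTrivialOn (p : V → X) (S : Set V) (u : V → X) : Prop :=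
  ∃ γ, IsInfRigidMotion γ ∧ ∀ v ∈ S, u v = γ (p v)

/-- The framework `(G,p)` is infinitesimally rigid. -/
def InfRigid (G : SimpleGraph V) (p : V → X) : Prop :=
  ∀ u, IsFlex G p u → IsTrivialOn p univ u

end NormedSpace

/-- A tower of finite subgraphs of `G`. -/
structure Tower (G : SimpleGraph V) where
  seq : ℕ → G.Subgraph
  mono : ∀ k, seq k ≤ seq (k + 1)
  finite : ∀ k, (seq k).verts.Finite

variable {G : SimpleGraph V}

/-- A tower is vertex-complete if its vertex sets exhaust the vertices of `G`. -/
def VertexComplete (T : Tower G) : Prop := (⋃ k, (T.seq k).verts) = univ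

/-- A tower is edge-complete if its edges exhaust the edges of `G`. -/
def EdgeComplete (T : Tower G) : Prop := ∀ ⦃v w⦄, G.Adj v w → ∃ k, (T.seq k).Adj v w

section NormedSpace

variable [NormedAddCommGroup X] [NormedSpace ℝ X]

/-- The flex cancellation property of a tower of frameworks: every non-trivial
infinitesimal flex of the `k`-th framework fails to extend to some later framework. -/
def FlexCancel (T : Tower G) (p : V → X) : Prop :=
  ∀ k u, IsFlex (T.seq k).spanningCoe p u → ¬ IsTrivialOn p (T.seq k).verts u →
    ∃ m, k < m ∧
      ¬ ∃ u', IsFlex (T.seq m).spanningCoe p u' ∧ ∀ v ∈ (T.seq k).verts, u' v = u v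

/-- A tower of frameworks is relatively infinitesimally rigid: no non-trivial
infinitesimal flex of the `k`-th framework extends to the `(k+1)`-st framework. -/
def RelRigidTower (T : Tower G) (p : V → X) : Prop :=
  ∀ k u, IsFlex (T.seq k).spanningCoe p u →
    (∃ u', IsFlex (T.seq (k + 1)).spanningCoe p u' ∧ ∀ v ∈ (T.seq k).verts, u' v = u v) →
    IsTrivialOn p (T.seq k).verts u

/-- The subframework on the subgraph `H` is infinitesimally rigid. -/
def SubInfRigid (H : G.Subgraph) (p : V → X) : Prop :=
  ∀ u, IsFlex H.spanningCoe p u → IsTrivialOn p H.verts u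

/-- The framework `(G,p)` is sequentially infinitesimally rigid. -/
def SeqInfRigid (G : SimpleGraph V) (p : V → X) : Prop :=
  ∃ T : Tower G, VertexComplete T ∧ ∀ k, SubInfRigid (T.seq k) p

end NormedSpace

/-! ### The `ℓ^q` norms on `ℝ^d` -/

/-- The `ℓ^q` norm on `ℝ^d`. -/
def qnorm (q : ℝ) {d : ℕ} (x : Fin d → ℝ) : ℝ := (∑ i, |x i| ^ q) ^ (1 / q)

/-- `u` is an infinitesimal flex of `(G,p)` in `(ℝ^d, ‖·‖_q)`. -/
def IsQFlex (q : ℝ) {d : ℕ} (G : SimpleGraph V) (p u : V → Fin d → ℝ) : Prop :=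
  ∀ ⦃v w⦄, G.Adj v w →
    (fun t : ℝ => qnorm q ((p v + t • u v) - (p w + t • u w)) - qnorm q (p v - p w))
      =o[𝓝 (0 : ℝ)] (fun t : ℝ => t)

/-- A continuous rigid motion of `(ℝ^d, ‖·‖_q)`. -/
def IsQContRigidMotion (q : ℝ) {d : ℕ} (Γ : (Fin d → ℝ) → ℝ → Fin d → ℝ) : Prop :=
  (∀ t ∈ Icc (-1 : ℝ) 1, ∀ x y, qnorm q (Γ x t - Γ y t) = qnorm q (x - y)) ∧
    (∀ x, ContinuousOn (Γ x) (Icc (-1 : ℝ) 1)) ∧ ∀ x, Γ x 0 = x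

/-- An infinitesimal rigid motion of `(ℝ^d, ‖·‖_q)`. -/
def IsQInfRigidMotion (q : ℝ) {d : ℕ} (γ : (Fin d → ℝ) → Fin d → ℝ) : Prop :=
  ∃ Γ, IsQContRigidMotion q Γ ∧ ∀ x, HasDerivWithinAt (Γ x) (γ x) (Icc (-1 : ℝ) 1) 0

/-- `u` is a trivial flex on the vertex set `S`, for the `ℓ^q` norm. -/
def IsQTrivialOn (q : ℝ) {d : ℕ} (p : V → Fin d → ℝ) (S : Set V) (u : V → Fin d → ℝ) : Prop :=
  ∃ γ, IsQInfRigidMotion q γ ∧ ∀ v ∈ S, u v = γ (p v)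

/-- The framework `(G,p)` is infinitesimally rigid in `(ℝ^d, ‖·‖_q)`. -/
def QInfRigid (q : ℝ) {d : ℕ} (G : SimpleGraph V) (p : V → Fin d → ℝ) : Prop :=
  ∀ u, IsQFlex q G p u → IsQTrivialOn q p univ u

/-- The subframework on the subgraph `H` is infinitesimally rigid in `(ℝ^d, ‖·‖_q)`. -/
def QSubInfRigid (q : ℝ) {d : ℕ} (H : G.Subgraph) (p : V → Fin d → ℝ) : Prop :=
  ∀ u, IsQFlex q H.spanningCoe p u → IsQTrivialOn q p H.verts u

/-! ### The rigidity matrix, regular and generic placements -/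

/-- The entry `sgn(a-b)|a-b|^{q-1}` of the rigidity matrix. -/
def rigidityCoef (q : ℝ) (a b : ℝ) : ℝ := Real.sign (a - b) * |a - b| ^ (q - 1)

/-- The row of the rigidity matrix `R_q(G,p)` corresponding to the (oriented) edge `vw`,
regarded as a vector in `ℝ^{V × d}`. -/
def rigidityRow (q : ℝ) {d : ℕ} (p : V → Fin d → ℝ) (v w : V) : V × Fin d → ℝ :=
  fun x =>
    (if x.1 = v then rigidityCoef q (p v x.2) (p w x.2) else 0) -
      (if x.1 = w then rigidityCoef q (p v x.2) (p w x.2) else 0)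

/-- The rank of the rigidity matrix `R_q(G,p)`, i.e. the dimension of its row space. -/
def rigidityRank (q : ℝ) {d : ℕ} (G : SimpleGraph V) (p : V → Fin d → ℝ) : ℕ :=
  Module.finrank ℝ
    (Submodule.span ℝ {r : V × Fin d → ℝ | ∃ v w, G.Adj v w ∧ r = rigidityRow q p v w})

/-- `(G,p)` is a regular framework in `(ℝ^d, ‖·‖_q)`: the rank of the rigidity matrix is
maximal at `p` over all placements of `G`. -/
def IsRegular (q : ℝ) {d : ℕ} (G : SimpleGraph V) (p : V → Fin d → ℝ) : Prop :=
  IsPlacement G p ∧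
    ∀ x : V → Fin d → ℝ, IsPlacement G x → rigidityRank q G x ≤ rigidityRank q G p

/-- `p` restricts on `W` to a generic placement: it is injective on `W` (a placement of the
complete graph on `W`) and every subframework of the complete graph on `W` is regular. -/
def GenericOn (q : ℝ) {d : ℕ} (p : V → Fin d → ℝ) (W : Set V) : Prop :=
  InjOn p W ∧ ∀ W' : Set V, W' ⊆ W → ∀ H : SimpleGraph W', IsRegular q H (fun x : W' => p x.1)

/-- `p` is a generic placement in `(ℝ^d, ‖·‖_q)`: its restriction to every finite set of
vertices is generic. -/
def IsGeneric (q : ℝ) {d : ℕ} (p : V → Fin d → ℝ) : Prop :=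
  ∀ W : Set V, W.Finite → GenericOn q p W

/-- The graph `G` is rigid in `(ℝ^d, ‖·‖_q)`: every generic placement is infinitesimally
rigid. -/
def Rigid (q : ℝ) (d : ℕ) (G : SimpleGraph V) : Prop :=
  ∀ p : V → Fin d → ℝ, IsGeneric q p → QInfRigid q G p

/-- The graph `G` is sequentially rigid in `(ℝ^d, ‖·‖_q)`: every generic placement is
sequentially infinitesimally rigid. -/
def SeqRigid (q : ℝ) (d : ℕ) (G : SimpleGraph V) : Prop :=
  ∀ p : V → Fin d → ℝ, IsGeneric q p →
    ∃ T : Tower G, VertexComplete T ∧ ∀ k, QSubInfRigid q (T.seq k) p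

/-- The graph `G` is minimally rigid in `(ℝ^d, ‖·‖_q)`. -/
def MinRigid (q : ℝ) (d : ℕ) (G : SimpleGraph V) : Prop :=
  Rigid q d G ∧
    ∀ p : V → Fin d → ℝ, IsGeneric q p → ∀ ⦃v w⦄, G.Adj v w →
      ¬ QInfRigid q (G.deleteEdges {s(v, w)}) p

/-! ### Continuous rigidity in `(ℝ^d, ‖·‖_q)` -/

/-- `α` is a continuous flex of `(G,p)` in `(ℝ^d, ‖·‖_q)`. -/
def IsQContFlex (q : ℝ) {d : ℕ} (G : SimpleGraph V) (p : V → Fin d → ℝ)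
    (α : V → ℝ → Fin d → ℝ) : Prop :=
  (∀ v, ContinuousOn (α v) (Icc (-1 : ℝ) 1)) ∧ (∀ v, α v 0 = p v) ∧
    ∀ ⦃v w⦄, G.Adj v w → ∀ t ∈ Icc (-1 : ℝ) 1, qnorm q (α v t - α w t) = qnorm q (p v - p w)

/-- `(G,p)` is continuously rigid in `(ℝ^d, ‖·‖_q)`: every continuous flex is trivial,
that is, derived from a continuous rigid motion. -/
def QContRigid (q : ℝ) {d : ℕ} (G : SimpleGraph V) (p : V → Fin d → ℝ) : Prop :=
  ∀ α, IsQContFlex q G p α →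
    ∃ Γ, IsQContRigidMotion q Γ ∧ ∀ v, ∀ t ∈ Icc (-1 : ℝ) 1, α v t = Γ (p v) t

/-! ### Sparsity counts -/

/-- A subgraph `H` is `(k,l)`-sparse. -/
def SubSparse (k l : ℕ) (H : G.Subgraph) : Prop :=
  ∀ H' : G.Subgraph, H' ≤ H → 2 ≤ H'.verts.ncard →
    (H'.edgeSet.ncard : ℤ) ≤ (k * H'.verts.ncard : ℤ) - l

/-- A subgraph `H` is `(k,l)`-tight. -/
def SubTight (k l : ℕ) (H : G.Subgraph) : Prop :=
  SubSparse k l H ∧ (H.edgeSet.ncard : ℤ) = (k * H.verts.ncard : ℤ) - l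

/-- A simple graph `G` (on its whole vertex type) is `(k,l)`-sparse. -/
def GraphSparse (k l : ℕ) (G : SimpleGraph V) : Prop :=
  ∀ H : G.Subgraph, 2 ≤ H.verts.ncard →
    (H.edgeSet.ncard : ℤ) ≤ (k * H.verts.ncard : ℤ) - l

/-! ### Graph moves -/

/-- Henneberg vertex extension move of degree 2: adjoin a new vertex `v` together with
edges to two distinct existing vertices. -/
def HennVertexMove (H H' : (⊤ : SimpleGraph V).Subgraph) : Prop :=
  ∃ v v₁ v₂, v ∉ H.verts ∧ v₁ ∈ H.verts ∧ v₂ ∈ H.verts ∧ v₁ ≠ v₂ ∧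
    H'.verts = insert v H.verts ∧
    ∀ a b, H'.Adj a b ↔
      (H.Adj a b ∨ (a = v ∧ (b = v₁ ∨ b = v₂)) ∨ (b = v ∧ (a = v₁ ∨ a = v₂)))

/-- Henneberg edge move of degree 2: remove an edge `v₁v₂` and adjoin a new vertex `v`
together with edges to `v₁`, `v₂` and a third existing vertex `v₃`. -/
def HennEdgeMove (H H' : (⊤ : SimpleGraph V).Subgraph) : Prop :=
  ∃ v v₁ v₂ v₃, v ∉ H.verts ∧ v₁ ∈ H.verts ∧ v₂ ∈ H.verts ∧ v₃ ∈ H.verts ∧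
    H.Adj v₁ v₂ ∧ v₃ ≠ v₁ ∧ v₃ ≠ v₂ ∧
    H'.verts = insert v H.verts ∧
    ∀ a b, H'.Adj a b ↔
      ((H.Adj a b ∧ ¬((a = v₁ ∧ b = v₂) ∨ (a = v₂ ∧ b = v₁))) ∨
        (a = v ∧ (b = v₁ ∨ b = v₂ ∨ b = v₃)) ∨ (b = v ∧ (a = v₁ ∨ a = v₂ ∨ a = v₃)))

/-- Vertex-to-`K₄` move: a vertex `w₀` is chosen, three new vertices `w₁,w₂,w₃` are
adjoined together with all edges among `{w₀,w₁,w₂,w₃}`, and every edge `xw₀` is either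
kept or replaced by an edge `x(f x)` with `f x ∈ {w₀,w₁,w₂,w₃}`. -/
def VertexToK4Move (H H' : (⊤ : SimpleGraph V).Subgraph) : Prop :=
  ∃ w₀ w₁ w₂ w₃, w₀ ∈ H.verts ∧ w₁ ∉ H.verts ∧ w₂ ∉ H.verts ∧ w₃ ∉ H.verts ∧
    w₁ ≠ w₂ ∧ w₁ ≠ w₃ ∧ w₂ ≠ w₃ ∧
    ∃ f : V → V, (∀ x, f x = w₀ ∨ f x = w₁ ∨ f x = w₂ ∨ f x = w₃) ∧
      H'.verts = insert w₁ (insert w₂ (insert w₃ H.verts)) ∧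
      ∀ a b, H'.Adj a b ↔
        ((H.Adj a b ∧ a ≠ w₀ ∧ b ≠ w₀) ∨
          (∃ x, H.Adj x w₀ ∧ ((a = x ∧ b = f x) ∨ (b = x ∧ a = f x))) ∨
          (a ∈ ({w₀, w₁, w₂, w₃} : Set V) ∧ b ∈ ({w₀, w₁, w₂, w₃} : Set V) ∧ a ≠ b))

/-- Vertex-to-4-cycle move: a vertex `v` with neighbours `v₁,v₂` is chosen, a new vertex
`v₀` is adjoined together with the edges `v₀v₁`, `v₀v₂`, and every other edge `vw` is
either kept or replaced by the edge `v₀w`. -/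
def VertexTo4CycleMove (H H' : (⊤ : SimpleGraph V).Subgraph) : Prop :=
  ∃ v v₀ v₁ v₂, v ∈ H.verts ∧ v₀ ∉ H.verts ∧ v₁ ≠ v₂ ∧
    H.Adj v v₁ ∧ H.Adj v v₂ ∧
    ∃ f : V → V, (∀ x, f x = v ∨ f x = v₀) ∧
      H'.verts = insert v₀ H.verts ∧
      ∀ a b, H'.Adj a b ↔
        ((H.Adj a b ∧ a ≠ v ∧ b ≠ v) ∨
          ((a = v ∨ a = v₀) ∧ (b = v₁ ∨ b = v₂)) ∨
          ((b = v ∨ b = v₀) ∧ (a = v₁ ∨ a = v₂)) ∨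
          (∃ w, H.Adj v w ∧ w ≠ v₁ ∧ w ≠ v₂ ∧ ((a = f w ∧ b = w) ∨ (b = f w ∧ a = w))))

/-! ### Multigraphs -/

/-- `(V',E')` is a subgraph of the multigraph with edge-endpoint map `ends`. -/
def MGSubgraph (ends : E → Sym2 V) (V' : Set V) (E' : Set E) : Prop :=
  ∀ e ∈ E', ∀ v ∈ ends e, v ∈ V'

/-- The (multigraph) subgraph `(V',E')` is `(k,l)`-sparse. -/
def MGSparseOn (k l : ℕ) (ends : E → Sym2 V) (V' : Set V) (E' : Set E) : Prop :=
  ∀ (V'' : Set V) (E'' : Set E), V'' ⊆ V' → E'' ⊆ E' → MGSubgraph ends V'' E'' →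
    2 ≤ V''.ncard → (E''.ncard : ℤ) ≤ (k * V''.ncard : ℤ) - l

/-- The (multigraph) subgraph `(V',E')` is `(k,l)`-tight. -/
def MGTightOn (k l : ℕ) (ends : E → Sym2 V) (V' : Set V) (E' : Set E) : Prop :=
  MGSparseOn k l ends V' E' ∧ (E'.ncard : ℤ) = (k * V'.ncard : ℤ) - l

/-- The degree of a vertex in a loopless multigraph. -/
def mgDeg (ends : E → Sym2 V) (v : V) : ℕ := {e | v ∈ ends e}.ncard

/-! ### Helper lemmas -/

/-- Number of ordered adjacent pairs in `A × B`. -/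
def nn {V : Type} (H : (⊤ : SimpleGraph V).Subgraph) (A B : Finset V) : ℕ :=
  ((A ×ˢ B).filter (fun p => H.Adj p.1 p.2)).card

/-- The vertex finset. -/
def vf {V : Type} [Fintype V] (H : (⊤ : SimpleGraph V).Subgraph) : Finset V :=
  Finset.univ.filter (fun v => v ∈ H.verts)

/-- Internal form of tightness. -/
def TT {V : Type} [Fintype V] (H : (⊤ : SimpleGraph V).Subgraph) : Prop :=
  (∀ S : Finset V, S.Nonempty → nn H S S + 4 ≤ 4 * S.card) ∧
    nn H (vf H) (vf H) + 4 = 4 * (vf H).card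

theorem mem_vf {V : Type} [Fintype V] (H : (⊤ : SimpleGraph V).Subgraph) (v : V) :
    v ∈ vf H ↔ v ∈ H.verts := by simp [vf]

theorem nn_union_left {V : Type} (H : (⊤ : SimpleGraph V).Subgraph) (A A' B : Finset V)
    (h : Disjoint A A') : nn H (A ∪ A') B = nn H A B + nn H A' B := by
  unfold nn
  rw [Finset.union_product, Finset.filter_union, Finset.card_union_of_disjoint]
  rw [Finset.disjoint_left] at h ⊢
  grind

theorem nn_comm {V : Type} (H : (⊤ : SimpleGraph V).Subgraph) (A B : Finset V) :
    nn H A B = nn H B A := by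
  unfold nn
  refine Finset.card_bij (fun p _ => (p.2, p.1)) ?_ ?_ ?_
  · intro p hp
    simp only [Finset.mem_filter, Finset.mem_product] at hp ⊢
    exact ⟨⟨hp.1.2, hp.1.1⟩, hp.2.symm⟩
  · grind
  · rintro ⟨a, b⟩ hp
    simp only [Finset.mem_filter, Finset.mem_product] at hp
    exact ⟨(b, a), by simp only [Finset.mem_filter, Finset.mem_product]; exact ⟨⟨hp.1.2, hp.1.1⟩, hp.2.symm⟩, rfl⟩

theorem nn_union_right {V : Type} (H : (⊤ : SimpleGraph V).Subgraph) (A B B' : Finset V)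
    (h : Disjoint B B') : nn H A (B ∪ B') = nn H A B + nn H A B' := by
  rw [nn_comm, nn_union_left _ _ _ _ h, nn_comm H B, nn_comm H B']

theorem nn_single {V : Type} (H : (⊤ : SimpleGraph V).Subgraph) (v : V) (S : Finset V) :
    nn H {v} S = (S.filter (fun w => H.Adj v w)).card := by
  unfold nn
  refine Finset.card_bij (fun p _ => p.2) ?_ ?_ ?_
  · grind
  · grind
  · intro b hb
    exact ⟨(v, b), by grind, rfl⟩

theorem nn_self {V : Type} (H : (⊤ : SimpleGraph V).Subgraph) (v : V) :
    nn H {v} {v} = 0 := by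
  rw [nn_single]
  have : ¬ H.Adj v v := fun h => h.ne rfl
  simp [Finset.filter_singleton, this]

theorem nn_insert {V : Type} (H : (⊤ : SimpleGraph V).Subgraph) (v : V) (S : Finset V)
    (h : v ∉ S) : nn H (insert v S) (insert v S) = nn H S S + 2 * nn H {v} S := by
  have hd : Disjoint {v} S := by simpa using h
  rw [Finset.insert_eq, nn_union_left _ _ _ _ hd, nn_union_right _ _ _ _ hd,
    nn_union_right _ _ _ _ hd, nn_self, nn_comm H S {v}]
  ring

theorem nn_even {V : Type} (H : (⊤ : SimpleGraph V).Subgraph) (S : Finset V) :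
    2 ∣ nn H S S := by
  induction S using Finset.induction_on with
  | empty => simp [nn]
  | insert v S h ih => rw [nn_insert _ _ _ h]; omega

theorem nn_mono {V : Type} (H K : (⊤ : SimpleGraph V).Subgraph) (S S' : Finset V)
    (h : ∀ a ∈ S, ∀ b ∈ S, K.Adj a b → a ∈ S' ∧ b ∈ S' ∧ H.Adj a b) :
    nn K S S ≤ nn H S' S' := by
  unfold nn
  apply Finset.card_le_card
  grind

theorem nn_super {V : Type} (H : (⊤ : SimpleGraph V).Subgraph) (A B : Finset V) :
    nn H A A + nn H B B ≤ nn H (A ∪ B) (A ∪ B) + nn H (A ∩ B) (A ∩ B) := by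
  unfold nn
  rw [← Finset.card_union_add_card_inter]
  apply Nat.add_le_add <;> apply Finset.card_le_card <;> intro p <;> simp <;> tauto

theorem three_nbrs {V : Type} [Fintype V] (H : (⊤ : SimpleGraph V).Subgraph) (hH : TT H)
    (S : Finset V) (hS : nn H S S + 4 = 4 * S.card) (u a b c : V) (hu : u ∉ S)
    (ha : a ∈ S) (hb : b ∈ S) (hc : c ∈ S) (hab : a ≠ b) (hac : a ≠ c) (hbc : b ≠ c)
    (hua : H.Adj u a) (hub : H.Adj u b) (huc : H.Adj u c) : False := by
  have h1 := hH.1 (insert u S) (Finset.insert_nonempty _ _)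
  rw [nn_insert _ _ _ hu, Finset.card_insert_of_notMem hu, nn_single] at h1
  have h2 : ({a, b, c} : Finset V).card ≤ (S.filter (fun w => H.Adj u w)).card := by
    apply Finset.card_le_card
    grind
  rw [Finset.card_eq_three.2 ⟨a, b, c, hab, hac, hbc, rfl⟩] at h2
  omega

theorem two_nbrs {V : Type} [Fintype V] (H : (⊤ : SimpleGraph V).Subgraph) (hH : TT H)
    (S : Finset V) (hS : nn H S S + 4 = 4 * S.card) (u a b : V) (hu : u ∉ S)
    (ha : a ∈ S) (hb : b ∈ S) (hab : a ≠ b)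
    (hua : H.Adj u a) (hub : H.Adj u b) :
    nn H (insert u S) (insert u S) + 4 = 4 * (insert u S).card := by
  have h1 := hH.1 (insert u S) (Finset.insert_nonempty _ _)
  rw [nn_insert _ _ _ hu, Finset.card_insert_of_notMem hu, nn_single] at h1 ⊢
  have h2 : ({a, b} : Finset V).card ≤ (S.filter (fun w => H.Adj u w)).card := by
    apply Finset.card_le_card
    grind
  rw [Finset.card_pair hab] at h2
  omega

theorem tight_union {V : Type} [Fintype V] (H : (⊤ : SimpleGraph V).Subgraph) (hH : TT H)
    (A B : Finset V) (hA : nn H A A + 4 = 4 * A.card) (hB : nn H B B + 4 = 4 * B.card)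
    (x : V) (hxA : x ∈ A) (hxB : x ∈ B) :
    nn H (A ∪ B) (A ∪ B) + 4 = 4 * (A ∪ B).card := by
  have h1 := nn_super H A B
  have h2 := hH.1 (A ∪ B) ⟨x, by simp [hxA]⟩
  have h3 := hH.1 (A ∩ B) ⟨x, by simp [hxA, hxB]⟩
  have h4 := Finset.card_union_add_card_inter A B
  omega

theorem edge_count {V : Type} [Fintype V] (H : (⊤ : SimpleGraph V).Subgraph) :
    nn H (vf H) (vf H) = 2 * H.edgeSet.ncard := by
  have h := SimpleGraph.sum_degrees_eq_twice_card_edges (G := H.spanningCoe)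
  have h1 : H.edgeSet.ncard = H.spanningCoe.edgeFinset.card := by
    rw [← SimpleGraph.Subgraph.edgeSet_spanningCoe, SimpleGraph.edgeFinset,
      Set.ncard_eq_toFinset_card']
  rw [h1, ← h]
  have h2 : ∀ v, H.spanningCoe.degree v = (Finset.univ.filter (fun w => H.Adj v w)).card := by
    intro v
    rw [← SimpleGraph.card_neighborFinset_eq_degree]
    congr 1
    ext w
    simp
  simp_rw [h2, Finset.card_filter]
  unfold nn
  rw [← Finset.sum_product', ← Finset.card_filter]
  congr 1
  ext ⟨a, b⟩
  simp only [Finset.mem_filter, Finset.mem_product, mem_vf, Finset.mem_univ, true_and]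
  constructor
  · tauto
  · intro h
    exact ⟨⟨H.edge_vert h, H.edge_vert h.symm⟩, h⟩

theorem TT_of_tight {V : Type} [Fintype V] (H : (⊤ : SimpleGraph V).Subgraph)
    (h : SubTight 2 2 H) : TT H := by
  have hv : ∀ K : (⊤ : SimpleGraph V).Subgraph, K.verts.ncard = (vf K).card := by
    intro K
    rw [Set.ncard_eq_toFinset_card']
    congr 1
    ext
    simp [mem_vf]
  obtain ⟨h1, h2⟩ := h
  have h3 := edge_count H
  rw [hv] at h2
  refine ⟨?_, by push_cast at h2; omega⟩
  have key : ∀ S : Finset V, S.Nonempty → (∀ x ∈ S, x ∈ H.verts) → nn H S S + 4 ≤ 4 * S.card := by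
    intro S hS hSH
    rcases Nat.lt_or_ge S.card 2 with hc | hc
    · have hc1 : S.card = 1 := by have := hS.card_pos; omega
      obtain ⟨x, rfl⟩ := Finset.card_eq_one.1 hc1
      simp [nn_self]
    · have hvf : vf (H.induce (S : Set V)) = S := by ext; simp [mem_vf]
      have h5 := h1 (H.induce (S : Set V)) ⟨hSH, fun a b h => h.2.2⟩ (by rw [hv, hvf]; exact hc)
      have h6 := edge_count (H.induce (S : Set V))
      rw [hv, hvf] at h5
      rw [hvf] at h6
      have h7 : nn H S S ≤ nn (H.induce (S : Set V)) S S :=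
        nn_mono _ _ _ _ (fun a ha b hb hab => ⟨ha, hb, by simpa using ⟨ha, hb, hab⟩⟩)
      push_cast at h5
      omega
  intro S hS
  rcases (S ∩ vf H).eq_empty_or_nonempty with he | he
  · have : nn H S S ≤ nn H ∅ ∅ := nn_mono _ _ _ _ (fun a ha b hb hab => by
      have : a ∈ S ∩ vf H := by simp [ha, mem_vf, H.edge_vert hab]
      simp [he] at this)
    have := hS.card_pos
    have : nn H ∅ ∅ = 0 := by simp [nn]
    omega
  · have h4 := key _ he (by intro x; simp [mem_vf])
    have h5 : nn H S S ≤ nn H (S ∩ vf H) (S ∩ vf H) := nn_mono _ _ _ _ (fun a ha b hb hab => by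
      simp [mem_vf, ha, hb, hab, H.edge_vert hab, H.edge_vert hab.symm])
    have := Finset.card_le_card (Finset.inter_subset_left : S ∩ vf H ⊆ S)
    omega

/-- Delete a vertex. -/
def delV {V : Type} (H : (⊤ : SimpleGraph V).Subgraph) (v : V) :
    (⊤ : SimpleGraph V).Subgraph where
  verts := H.verts \ {v}
  Adj a b := H.Adj a b ∧ a ≠ v ∧ b ≠ v
  adj_sub h := H.adj_sub h.1
  edge_vert h := ⟨H.edge_vert h.1, h.2.1⟩
  symm := ⟨fun _ _ h => ⟨h.1.symm, h.2.2, h.2.1⟩⟩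

/-- Delete a vertex and add an edge. -/
def delAdd {V : Type} (H : (⊤ : SimpleGraph V).Subgraph) (v x y : V) (hxy : x ≠ y)
    (hx : x ∈ H.verts) (hy : y ∈ H.verts) (hxv : x ≠ v) (hyv : y ≠ v) :
    (⊤ : SimpleGraph V).Subgraph where
  verts := H.verts \ {v}
  Adj a b := (H.Adj a b ∧ a ≠ v ∧ b ≠ v) ∨ (a = x ∧ b = y) ∨ (a = y ∧ b = x)
  adj_sub h := by
    rcases h with h | ⟨rfl, rfl⟩ | ⟨rfl, rfl⟩
    · exact H.adj_sub h.1
    · exact hxy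
    · exact hxy.symm
  edge_vert h := by
    rcases h with h | ⟨rfl, rfl⟩ | ⟨rfl, rfl⟩
    · exact ⟨H.edge_vert h.1, h.2.1⟩
    · exact ⟨hx, hxv⟩
    · exact ⟨hy, hyv⟩
  symm := ⟨fun a b h => by
    rcases h with h | ⟨rfl, rfl⟩ | ⟨rfl, rfl⟩
    · exact Or.inl ⟨h.1.symm, h.2.2, h.2.1⟩
    · exact Or.inr (Or.inr ⟨rfl, rfl⟩)
    · exact Or.inr (Or.inl ⟨rfl, rfl⟩)⟩

theorem nn_delV {V : Type} (H : (⊤ : SimpleGraph V).Subgraph) (v : V) (S : Finset V) :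
    nn (delV H v) S S = nn H (S.erase v) (S.erase v) := by
  unfold nn
  congr 1
  ext p
  simp only [Finset.mem_filter, Finset.mem_product, Finset.mem_erase]
  simp only [delV]
  tauto

theorem nn_erase {V : Type} (H : (⊤ : SimpleGraph V).Subgraph) (v : V) (S : Finset V)
    (h : v ∈ S) : nn H S S = nn H (S.erase v) (S.erase v) + 2 * nn H {v} S := by
  have h1 := nn_insert H v (S.erase v) (by simp)
  rw [Finset.insert_erase h] at h1
  have h2 : nn H {v} S = nn H {v} (S.erase v) := by
    rw [nn_single, nn_single]
    congr 1
    ext w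
    have : ¬ H.Adj v v := fun h => h.ne rfl
    grind
  rw [h1, h2]

theorem vf_del {V : Type} [Fintype V] (H K : (⊤ : SimpleGraph V).Subgraph) (v : V)
    (h : K.verts = H.verts \ {v}) : vf K = (vf H).erase v := by
  ext w
  simp [mem_vf, h]
  tauto

theorem sparse_erase {V : Type} [Fintype V] (H : (⊤ : SimpleGraph V).Subgraph) (hH : TT H)
    (v : V) (S : Finset V) (hS : S.Nonempty) :
    nn H (S.erase v) (S.erase v) + 4 ≤ 4 * S.card := by
  rcases (S.erase v).eq_empty_or_nonempty with he | he
  · have := hS.card_pos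
    rw [he]
    have : nn H ∅ ∅ = 0 := by simp [nn]
    omega
  · have := hH.1 _ he
    have := Finset.card_le_card (Finset.erase_subset v S)
    omega

theorem TT_delV {V : Type} [Fintype V] (H : (⊤ : SimpleGraph V).Subgraph) (hH : TT H) (v : V)
    (hv : v ∈ H.verts) (hd : nn H {v} (vf H) = 2) : TT (delV H v) := by
  have hv' : v ∈ vf H := (mem_vf _ _).2 hv
  constructor
  · intro S hS
    rw [nn_delV]
    exact sparse_erase H hH v S hS
  · rw [nn_delV, vf_del H _ v rfl, Finset.erase_idem]
    have h1 := nn_erase H v _ hv'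
    have h2 := Finset.card_erase_add_one hv'
    have h3 := hH.2
    omega

theorem TT_delAdd {V : Type} [Fintype V] (H : (⊤ : SimpleGraph V).Subgraph) (hH : TT H)
    (v x y : V) (hxy : x ≠ y)
    (hx : x ∈ H.verts) (hy : y ∈ H.verts) (hxv : x ≠ v) (hyv : y ≠ v)
    (hv : v ∈ H.verts) (hd : nn H {v} (vf H) = 3) (hadj : ¬ H.Adj x y)
    (hun : ∀ T : Finset V, x ∈ T → y ∈ T → v ∉ T → nn H T T + 4 ≠ 4 * T.card) :
    TT (delAdd H v x y hxy hx hy hxv hyv) := by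
  have hv' : v ∈ vf H := (mem_vf _ _).2 hv
  have hin : ∀ S : Finset V, x ∈ S → y ∈ S → nn (delAdd H v x y hxy hx hy hxv hyv) S S =
      nn H (S.erase v) (S.erase v) + 2 := by
    intro S hxS hyS
    unfold nn
    have : ((S ×ˢ S).filter (fun p => (delAdd H v x y hxy hx hy hxv hyv).Adj p.1 p.2)) =
      (((S.erase v) ×ˢ (S.erase v)).filter (fun p => H.Adj p.1 p.2)) ∪ {(x, y), (y, x)} := by
      ext ⟨a, b⟩
      simp only [delAdd, Finset.mem_filter, Finset.mem_product, Finset.mem_erase,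
        Finset.mem_union, Finset.mem_insert, Finset.mem_singleton, Prod.mk.injEq]
      grind
    rw [this, Finset.card_union_of_disjoint, Finset.card_pair]
    · simp [hxy]
    · rw [Finset.disjoint_left]
      rintro ⟨a, b⟩ h1 h2
      simp only [Finset.mem_filter, Finset.mem_insert, Finset.mem_singleton, Prod.mk.injEq] at h1 h2
      rcases h2 with ⟨rfl, rfl⟩ | ⟨rfl, rfl⟩
      · exact hadj h1.2
      · exact hadj h1.2.symm
  constructor
  · intro S hS
    by_cases hxS : x ∈ S ∧ y ∈ S
    · rw [hin S hxS.1 hxS.2]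
      have h1 := hH.1 (S.erase v) ⟨x, by simp [hxv, hxS.1]⟩
      have h2 := hun (S.erase v) (by simp [hxv, hxS.1]) (by simp [hyv, hxS.2]) (by simp)
      have h3 := nn_even H (S.erase v)
      have h4 := Finset.card_le_card (Finset.erase_subset v S)
      omega
    · have h1 : nn (delAdd H v x y hxy hx hy hxv hyv) S S ≤ nn H (S.erase v) (S.erase v) := by
        apply nn_mono
        intro a ha b hb hab
        simp only [delAdd] at hab
        grind
      have := sparse_erase H hH v S hS
      omega
  · rw [vf_del H _ v rfl, hin _ (by simp [hxv, mem_vf, hx]) (by simp [hyv, mem_vf, hy]),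
      Finset.erase_idem]
    have h1 := nn_erase H v _ hv'
    have h2 := Finset.card_erase_add_one hv'
    have h3 := hH.2
    omega

/-- Contract a set `Q` to the vertex `w`. -/
def contr {V : Type} (H : (⊤ : SimpleGraph V).Subgraph) (Q : Finset V) (w : V)
    (hw : w ∈ Q) (hwH : w ∈ H.verts) :
    (⊤ : SimpleGraph V).Subgraph where
  verts := {a | a ∈ H.verts ∧ (a ∉ Q ∨ a = w)}
  Adj a b := (H.Adj a b ∧ a ∉ Q ∧ b ∉ Q) ∨ (a = w ∧ b ∉ Q ∧ ∃ k ∈ Q, H.Adj k b) ∨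
    (b = w ∧ a ∉ Q ∧ ∃ k ∈ Q, H.Adj k a)
  adj_sub h := by
    rcases h with h | ⟨rfl, h, _⟩ | ⟨rfl, h, _⟩
    · exact H.adj_sub h.1
    · rintro rfl
      exact h hw
    · rintro rfl
      exact h hw
  edge_vert h := by
    rcases h with h | ⟨rfl, h, _⟩ | ⟨rfl, h, k, hk, hka⟩
    · exact ⟨H.edge_vert h.1, Or.inl h.2.1⟩
    · exact ⟨hwH, Or.inr rfl⟩
    · exact ⟨H.edge_vert hka.symm, Or.inl h⟩
  symm := ⟨fun a b h => by
    rcases h with h | h | h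
    · exact Or.inl ⟨h.1.symm, h.2.2, h.2.1⟩
    · exact Or.inr (Or.inr h)
    · exact Or.inr (Or.inl h)⟩

theorem TT_contr {V : Type} [Fintype V] (H : (⊤ : SimpleGraph V).Subgraph) (hH : TT H)
    (Q : Finset V) (w : V) (hw : w ∈ Q) (hwH : w ∈ H.verts) (hQH : ∀ q ∈ Q, q ∈ H.verts)
    (hQ : nn H Q Q + 4 = 4 * Q.card)
    (huniq : ∀ x ∉ Q, ∀ k ∈ Q, ∀ l ∈ Q, H.Adj x k → H.Adj x l → k = l) :
    TT (contr H Q w hw hwH) := by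
  -- pairs not both in Q
  have split : ∀ S : Finset V, Q ⊆ S → nn H S S = nn H Q Q +
      ((S ×ˢ S).filter (fun p => H.Adj p.1 p.2 ∧ ¬ (p.1 ∈ Q ∧ p.2 ∈ Q))).card := by
    intro S hS
    unfold nn
    rw [← Finset.card_union_of_disjoint]
    · congr 1
      ext ⟨a, b⟩
      simp only [Finset.mem_filter, Finset.mem_product, Finset.mem_union]
      have := @hS a
      have := @hS b
      tauto
    · rw [Finset.disjoint_left]
      rintro ⟨a, b⟩
      simp only [Finset.mem_filter, Finset.mem_product]
      tauto
  let π : V → V := fun a => if a ∈ Q then w else a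
  have himg : ∀ S : Finset V, w ∈ S →
      ((S ×ˢ S).filter (fun p => (contr H Q w hw hwH).Adj p.1 p.2)) ⊆
      (((S ∪ Q) ×ˢ (S ∪ Q)).filter
        (fun p => H.Adj p.1 p.2 ∧ ¬ (p.1 ∈ Q ∧ p.2 ∈ Q))).image (fun p => (π p.1, π p.2)) := by
    rintro S hS ⟨a, b⟩ h
    simp only [Finset.mem_filter, Finset.mem_product] at h
    simp only [contr] at h
    simp only [Finset.mem_filter, Finset.mem_product, Finset.mem_image, Finset.mem_union,
      Prod.mk.injEq, π]
    obtain ⟨⟨ha, hb⟩, h | ⟨rfl, h, k, hk, hkb⟩ | ⟨rfl, h, k, hk, hkb⟩⟩ := h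
    · exact ⟨(a, b), by simp [ha, hb, h], by simp [h]⟩
    · exact ⟨(k, b), by simp [hk, hb, hkb, h], by simp [hk, h]⟩
    · exact ⟨(a, k), by simp [hk, ha, hkb.symm, h], by simp [hk, h]⟩
  have hcardU : ∀ S : Finset V, w ∈ S → (S ∪ Q).card + 1 ≤ S.card + Q.card := by
    intro S hS
    rw [← Finset.card_union_add_card_inter]
    have : 0 < (S ∩ Q).card := Finset.card_pos.2 ⟨w, by simp [hS, hw]⟩
    omega
  constructor
  · intro S hS
    by_cases hwS : w ∈ S
    · have h1 := Finset.card_le_card (himg S hwS)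
      have h2 := h1.trans Finset.card_image_le
      have h3 := split (S ∪ Q) Finset.subset_union_right
      have h4 := hH.1 (S ∪ Q) ⟨w, by simp [hw]⟩
      have h5 := hcardU S hwS
      unfold nn at *
      omega
    · have h1 : nn (contr H Q w hw hwH) S S ≤ nn H S S := by
        apply nn_mono
        intro a ha b hb hab
        simp only [contr] at hab
        grind
      have := hH.1 S hS
      omega
  · set K := contr H Q w hw hwH with hK
    have hwK : w ∈ vf K := by rw [mem_vf]; exact ⟨hwH, Or.inr rfl⟩
    have hU : vf K ∪ Q = vf H := by
      ext a
      simp only [Finset.mem_union, mem_vf, hK, contr, Set.mem_ofPred_eq]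
      have := hQH a
      tauto
    have hI : vf K ∩ Q = {w} := by
      ext a
      simp only [Finset.mem_inter, mem_vf, hK, contr, Set.mem_ofPred_eq, Finset.mem_singleton]
      grind
    have hc := Finset.card_union_add_card_inter (vf K) Q
    rw [hU, hI, Finset.card_singleton] at hc
    have hs := split (vf H) (by intro q hq; exact (mem_vf _ _).2 (hQH q hq))
    have hle := himg (vf K) hwK
    rw [hU] at hle
    have hge : (((vf H) ×ˢ (vf H)).filter
        (fun p => H.Adj p.1 p.2 ∧ ¬ (p.1 ∈ Q ∧ p.2 ∈ Q))).image (fun p => (π p.1, π p.2)) ⊆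
        ((vf K ×ˢ vf K).filter (fun p => K.Adj p.1 p.2)) := by
      intro p hp
      rw [Finset.mem_image] at hp
      obtain ⟨⟨a, b⟩, hab, rfl⟩ := hp
      simp only [Finset.mem_filter, Finset.mem_product] at hab
      have hA : K.Adj (π a) (π b) := by
        simp only [hK, contr, π]
        obtain ⟨_, hab, hn⟩ := hab
        have hba := hab.symm
        by_cases ha : a ∈ Q <;> by_cases hb : b ∈ Q
        · exact absurd ⟨ha, hb⟩ hn
        · rw [if_pos ha, if_neg hb]
          exact Or.inr (Or.inl ⟨rfl, hb, a, ha, hab⟩)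
        · rw [if_neg ha, if_pos hb]
          exact Or.inr (Or.inr ⟨rfl, ha, b, hb, hba⟩)
        · rw [if_neg ha, if_neg hb]
          exact Or.inl ⟨hab, ha, hb⟩
      simp only [Finset.mem_filter, Finset.mem_product, mem_vf]
      exact ⟨⟨K.edge_vert hA, K.edge_vert hA.symm⟩, hA⟩
    have heq := congrArg Finset.card (Finset.Subset.antisymm hle hge)
    rw [Finset.card_image_of_injOn] at heq
    · have := hH.2
      unfold nn at *
      omega
    · rintro ⟨a, b⟩ h1 ⟨c, d⟩ h2 h
      simp only [Finset.coe_filter, Set.mem_ofPred_eq, Finset.mem_product, Prod.mk.injEq, π] at h1 h2 h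
      obtain ⟨_, h1, h1n⟩ := h1
      obtain ⟨_, h2, h2n⟩ := h2
      have h1' := h1.symm
      have h2' := h2.symm
      rw [Prod.mk.injEq]
      clear himg hle hge split
      by_cases ha : a ∈ Q <;> by_cases hb : b ∈ Q <;> by_cases hc : c ∈ Q <;>
        by_cases hd : d ∈ Q <;> simp only [ha, hb, hc, hd, if_true, if_false] at h <;> grind

/-- One inverse step. -/
def Step {V : Type} [Fintype V] (G G' : (⊤ : SimpleGraph V).Subgraph) : Prop :=
  ∃ K : (⊤ : SimpleGraph V).Subgraph, TT K ∧ G ≤ K ∧ (vf K).card < (vf G').card ∧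
    (HennVertexMove K G' ∨ HennEdgeMove K G' ∨ VertexToK4Move K G' ∨ VertexTo4CycleMove K G')

theorem sub_tight {V : Type} [Fintype V] (G G' : (⊤ : SimpleGraph V).Subgraph) (hle : G ≤ G')
    (hG : TT G) (hG' : TT G') : nn G' (vf G) (vf G) + 4 = 4 * (vf G).card := by
  have h1 : nn G (vf G) (vf G) ≤ nn G' (vf G) (vf G) :=
    nn_mono _ _ _ _ (fun a ha b hb hab => ⟨ha, hb, hle.2 hab⟩)
  have h2 := hG.2
  have h3 := hG'.1 (vf G) (Finset.card_pos.1 (by omega))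
  omega

theorem eq_of_verts {V : Type} [Fintype V] (G G' : (⊤ : SimpleGraph V).Subgraph) (hle : G ≤ G')
    (hG : TT G) (hG' : TT G') (hv : ∀ v ∈ G'.verts, v ∈ G.verts) : G = G' := by
  have hvv : G.verts = G'.verts := Set.Subset.antisymm hle.1 hv
  have h1 := sub_tight G G' hle hG hG'
  have h2 := hG.2
  have h3 : ((vf G ×ˢ vf G).filter (fun p => G.Adj p.1 p.2)) =
      ((vf G ×ˢ vf G).filter (fun p => G'.Adj p.1 p.2)) := by
    apply Finset.eq_of_subset_of_card_le
    · intro p hp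
      rw [Finset.mem_filter] at hp ⊢
      exact ⟨hp.1, hle.2 hp.2⟩
    · unfold nn at h1 h2
      omega
  refine SimpleGraph.Subgraph.ext hvv ?_
  ext a b
  constructor
  · intro h
    exact hle.2 h
  · intro h
    have : (a, b) ∈ ((vf G ×ˢ vf G).filter (fun p => G.Adj p.1 p.2)) := by
      rw [h3]
      simp only [Finset.mem_filter, Finset.mem_product, mem_vf]
      exact ⟨⟨hv _ (G'.edge_vert h), hv _ (G'.edge_vert h.symm)⟩, h⟩
    exact (Finset.mem_filter.1 this).2

theorem nn_sum {V : Type} (H : (⊤ : SimpleGraph V).Subgraph) (A B : Finset V) :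
    nn H A B = ∑ a ∈ A, nn H {a} B := by
  induction A using Finset.induction_on with
  | empty => simp [nn]
  | insert v S h ih =>
    rw [Finset.sum_insert h, ← ih, Finset.insert_eq, nn_union_left _ _ _ _ (by simpa using h)]

theorem exists_low {V : Type} [Fintype V] (G G' : (⊤ : SimpleGraph V).Subgraph) (hle : G ≤ G')
    (hG : TT G) (hG' : TT G') (hne : G ≠ G') :
    ∃ v, v ∈ G'.verts ∧ v ∉ G.verts ∧ (nn G' {v} (vf G') = 2 ∨ nn G' {v} (vf G') = 3) := by
  have h1 := sub_tight G G' hle hG hG'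
  have hsub : vf G ⊆ vf G' := by
    intro x hx
    rw [mem_vf] at *
    exact hle.1 hx
  have hlow : ∃ v ∈ vf G' \ vf G, nn G' {v} (vf G') < 4 := by
    by_contra hcon
    push Not at hcon
    have hO : (vf G' \ vf G).Nonempty := by
      by_contra hO
      rw [Finset.not_nonempty_iff_eq_empty, Finset.sdiff_eq_empty_iff_subset] at hO
      exact hne (eq_of_verts G G' hle hG hG' (fun v hv => (mem_vf _ _).1 (hO ((mem_vf _ _).2 hv))))
    have hU : (vf G' \ vf G) ∪ vf G = vf G' := Finset.sdiff_union_of_subset hsub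
    have hd : Disjoint (vf G' \ vf G) (vf G) := Finset.sdiff_disjoint
    have hc := Finset.card_union_of_disjoint hd
    have hs := Finset.card_nsmul_le_sum _ _ _ hcon
    rw [← nn_sum] at hs
    have h2 := hG'.2
    have h3 := hG'.1 _ hO
    set O := vf G' \ vf G
    rw [← hU] at h2 hs
    rw [nn_union_right _ _ _ _ hd] at hs
    rw [nn_union_right _ _ _ _ hd, nn_union_left _ _ _ _ hd, nn_union_left _ _ _ _ hd,
      nn_comm G' (vf G) O] at h2
    simp only [smul_eq_mul] at hs
    omega
  obtain ⟨v, hv, h4⟩ := hlow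
  rw [Finset.mem_sdiff] at hv
  refine ⟨v, (mem_vf _ _).1 hv.1, fun h => hv.2 ((mem_vf _ _).2 h), ?_⟩
  have h5 := nn_erase G' v _ hv.1
  have h6 := Finset.card_erase_add_one hv.1
  have h7 : (vf G).Nonempty := Finset.card_pos.1 (by omega)
  obtain ⟨x, hx⟩ := h7
  have h8 := hG'.1 ((vf G').erase v) ⟨x, by
    rw [Finset.mem_erase]
    exact ⟨fun h => hv.2 (h ▸ hx), hsub hx⟩⟩
  have h9 := hG'.2
  omega

theorem card_del_lt {V : Type} [Fintype V] (H K : (⊤ : SimpleGraph V).Subgraph) (v : V)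
    (hv : v ∈ H.verts) (h : K.verts = H.verts \ {v}) : (vf K).card < (vf H).card := by
  rw [vf_del H K v h]
  exact Finset.card_erase_lt_of_mem ((mem_vf _ _).2 hv)

theorem insert_del {V : Type} (A : Set V) (v : V) (hv : v ∈ A) : A = insert v (A \ {v}) := by
  simp [Set.insert_eq_of_mem hv]

theorem step_two {V : Type} [Fintype V] (G G' : (⊤ : SimpleGraph V).Subgraph) (hle : G ≤ G')
    (hG' : TT G') (v : V) (hv : v ∈ G'.verts) (hvG : v ∉ G.verts)
    (hd : nn G' {v} (vf G') = 2) : Step G G' := by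
  have hd' := hd
  rw [nn_single, Finset.card_eq_two] at hd'
  obtain ⟨x, y, hxy, h⟩ := hd'
  have hn : ∀ w, G'.Adj v w ↔ (w = x ∨ w = y) := by
    intro w
    have := Finset.ext_iff.1 h w
    simp only [Finset.mem_filter, mem_vf, Finset.mem_insert, Finset.mem_singleton] at this
    rw [← this]
    exact ⟨fun h => ⟨G'.edge_vert h.symm, h⟩, fun h => h.2⟩
  have hx : G'.Adj v x := (hn x).2 (Or.inl rfl)
  have hy : G'.Adj v y := (hn y).2 (Or.inr rfl)
  refine ⟨delV G' v, TT_delV G' hG' v hv hd, ⟨?_, ?_⟩, card_del_lt _ _ v hv rfl, Or.inl ?_⟩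
  · intro a ha
    exact ⟨hle.1 ha, fun h => hvG (h ▸ ha)⟩
  · intro a b hab
    exact ⟨hle.2 hab, fun h => hvG (h ▸ G.edge_vert hab), fun h => hvG (h ▸ G.edge_vert hab.symm)⟩
  · refine ⟨v, x, y, fun h => h.2 rfl, ⟨G'.edge_vert hx.symm, hx.ne.symm⟩,
      ⟨G'.edge_vert hy.symm, hy.ne.symm⟩, hxy, insert_del _ _ hv, ?_⟩
    intro a b
    have h1 := hn a
    have h2 := hn b
    have h3 := G'.adj_comm a b
    simp only [delV]
    grind

theorem le_delAdd {V : Type} (G G' : (⊤ : SimpleGraph V).Subgraph) (hle : G ≤ G')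
    (v x y : V) (hxy : x ≠ y)
    (hx : x ∈ G'.verts) (hy : y ∈ G'.verts) (hxv : x ≠ v) (hyv : y ≠ v) (hvG : v ∉ G.verts) :
    G ≤ delAdd G' v x y hxy hx hy hxv hyv := by
  constructor
  · intro a ha
    exact ⟨hle.1 ha, fun h => hvG (h ▸ ha)⟩
  · intro a b hab
    exact Or.inl ⟨hle.2 hab, fun h => hvG (h ▸ G.edge_vert hab),
      fun h => hvG (h ▸ G.edge_vert hab.symm)⟩

theorem step_edge {V : Type} [Fintype V] (G G' : (⊤ : SimpleGraph V).Subgraph) (hle : G ≤ G')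
    (hG' : TT G') (v : V) (hv : v ∈ G'.verts) (hvG : v ∉ G.verts)
    (hd : nn G' {v} (vf G') = 3) (x y z : V) (hxy : x ≠ y) (hxz : x ≠ z) (hyz : y ≠ z)
    (hn : ∀ w, G'.Adj v w ↔ (w = x ∨ w = y ∨ w = z)) (hadj : ¬ G'.Adj x y)
    (hun : ∀ T : Finset V, x ∈ T → y ∈ T → v ∉ T → nn G' T T + 4 ≠ 4 * T.card) :
    Step G G' := by
  have hx : G'.Adj v x := (hn x).2 (by simp)
  have hy : G'.Adj v y := (hn y).2 (by simp)
  have hz : G'.Adj v z := (hn z).2 (by simp)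
  have hxV := G'.edge_vert hx.symm
  have hyV := G'.edge_vert hy.symm
  have hzV := G'.edge_vert hz.symm
  have hxv := hx.ne.symm
  have hyv := hy.ne.symm
  refine ⟨delAdd G' v x y hxy hxV hyV hxv hyv,
    TT_delAdd G' hG' v x y hxy hxV hyV hxv hyv hv hd hadj hun,
    le_delAdd G G' hle v x y hxy hxV hyV hxv hyv hvG, card_del_lt _ _ v hv rfl,
    Or.inr (Or.inl ?_)⟩
  refine ⟨v, x, y, z, fun h => h.2 rfl, ⟨hxV, hxv⟩, ⟨hyV, hyv⟩, ⟨hzV, hz.ne.symm⟩,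
    Or.inr (Or.inl ⟨rfl, rfl⟩), hxz.symm, hyz.symm, insert_del _ _ hv, ?_⟩
  intro a b
  have h1 := hn a
  have h2 := hn b
  have h3 := G'.adj_comm a b
  simp only [delAdd]
  grind

theorem step_three {V : Type} [Fintype V] (G G' : (⊤ : SimpleGraph V).Subgraph) (hle : G ≤ G')
    (hG' : TT G') (v : V) (hv : v ∈ G'.verts) (hvG : v ∉ G.verts)
    (hd : nn G' {v} (vf G') = 3) (a b c : V) (hab : a ≠ b) (hac : a ≠ c) (hbc : b ≠ c)
    (hn : ∀ w, G'.Adj v w ↔ (w = a ∨ w = b ∨ w = c)) (hadj : ¬ G'.Adj a b) :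
    Step G G' := by
  have hA : G'.Adj v a := (hn a).2 (by simp)
  have hB : G'.Adj v b := (hn b).2 (by simp)
  have hC : G'.Adj v c := (hn c).2 (by simp)
  have bad : ∀ T : Finset V, a ∈ T → b ∈ T → c ∈ T → v ∉ T → nn G' T T + 4 = 4 * T.card → False :=
    fun T ha hb hc hvT hT => three_nbrs G' hG' T hT v a b c hvT ha hb hc hab hac hbc hA hB hC
  by_cases hbl : ∀ T : Finset V, a ∈ T → b ∈ T → v ∉ T → nn G' T T + 4 ≠ 4 * T.card
  · exact step_edge G G' hle hG' v hv hvG hd a b c hab hac hbc hn hadj hbl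
  push Not at hbl
  obtain ⟨T, haT, hbT, hvT, hT⟩ := hbl
  have hcT : c ∉ T := fun hcT => bad T haT hbT hcT hvT hT
  by_cases h1 : G'.Adj a c
  · by_cases h2 : G'.Adj b c
    · exfalso
      have := two_nbrs G' hG' T hT c a b hcT haT hbT hab h1.symm h2.symm
      exact bad _ (by simp [haT]) (by simp [hbT]) (by simp) (by simp [hvT, hC.ne]) this
    · refine step_edge G G' hle hG' v hv hvG hd b c a hbc hab.symm hac.symm
        (fun w => by rw [hn]; tauto) h2 ?_
      intro T' hbT' hcT' hvT' hT'
      exact bad (T ∪ T') (by simp [haT]) (by simp [hbT]) (by simp [hcT']) (by simp [hvT, hvT'])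
        (tight_union G' hG' T T' hT hT' b hbT hbT')
  · refine step_edge G G' hle hG' v hv hvG hd a c b hac hab hbc.symm
        (fun w => by rw [hn]; tauto) h1 ?_
    intro T' haT' hcT' hvT' hT'
    exact bad (T ∪ T') (by simp [haT]) (by simp [hbT]) (by simp [hcT']) (by simp [hvT, hvT'])
      (tight_union G' hG' T T' hT hT' a haT haT')

theorem K4_tight {V : Type} [Fintype V] (H : (⊤ : SimpleGraph V).Subgraph) (v a b c : V)
    (hva : H.Adj v a) (hvb : H.Adj v b) (hvc : H.Adj v c)
    (hab : H.Adj a b) (hac : H.Adj a c) (hbc : H.Adj b c) :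
    nn H {v, a, b, c} {v, a, b, c} + 4 = 4 * ({v, a, b, c} : Finset V).card := by
  have h1 : nn H {v, a, b, c} {v, a, b, c} = (({v, a, b, c} : Finset V).offDiag).card := by
    unfold nn
    congr 1
    ext ⟨p, q⟩
    have h2 := hva.symm
    have h3 := hvb.symm
    have h4 := hvc.symm
    have h5 := hab.symm
    have h6 := hac.symm
    have h7 := hbc.symm
    have h8 : H.Adj p q → p ≠ q := fun h => h.ne
    simp only [Finset.mem_filter, Finset.mem_product, Finset.mem_offDiag]
    constructor
    · tauto
    · rintro ⟨hp, hq, hpq⟩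
      refine ⟨⟨hp, hq⟩, ?_⟩
      simp only [Finset.mem_insert, Finset.mem_singleton] at hp hq
      rcases hp with rfl | rfl | rfl | rfl <;> rcases hq with rfl | rfl | rfl | rfl <;>
        first | assumption | exact absurd rfl hpq
  have h9 : ({v, a, b, c} : Finset V).card = 4 := by
    rw [Finset.card_insert_of_notMem, Finset.card_eq_three.2 ⟨a, b, c, hab.ne, hac.ne, hbc.ne, rfl⟩]
    simp [hva.ne, hvb.ne, hvc.ne]
  rw [h1, Finset.offDiag_card, h9]

theorem step_cycle {V : Type} [Fintype V] (G G' : (⊤ : SimpleGraph V).Subgraph) (hle : G ≤ G')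
    (hG' : TT G') (v : V) (hv : v ∈ G'.verts) (hvG : v ∉ G.verts)
    (hd : nn G' {v} (vf G') = 3) (a b c x : V)
    (hab : G'.Adj a b) (hac : G'.Adj a c) (hbc : G'.Adj b c)
    (hn : ∀ w, G'.Adj v w ↔ (w = a ∨ w = b ∨ w = c)) (hxv : x ≠ v) (hxc : x ≠ c)
    (hxa : G'.Adj x a) (hxb : G'.Adj x b) : Step G G' := by
  have hA : G'.Adj v a := (hn a).2 (by simp)
  have hB : G'.Adj v b := (hn b).2 (by simp)
  have hC : G'.Adj v c := (hn c).2 (by simp)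
  have hxV := G'.edge_vert hxa
  have hcV := G'.edge_vert hC.symm
  have hcv := hC.ne.symm
  have hadj : ¬ G'.Adj x c := by
    intro h
    exact three_nbrs G' hG' {v, a, b, c} (K4_tight G' v a b c hA hB hC hab hac hbc) x a b c
      (by simp [hxv, hxc, hxa.ne, hxb.ne]) (by simp) (by simp) (by simp) hab.ne hac.ne hbc.ne
      hxa hxb h
  have bad : ∀ T : Finset V, a ∈ T → x ∈ T → c ∈ T → v ∉ T → nn G' T T + 4 = 4 * T.card → False := by
    intro T ha hx hc hvT hT
    by_cases hb : b ∈ T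
    · exact three_nbrs G' hG' T hT v a b c hvT ha hb hc hab.ne hac.ne hbc.ne hA hB hC
    · exact three_nbrs G' hG' T hT b a x c hb ha hx hc hxa.ne.symm hac.ne hxc hab.symm hxb.symm hbc
  refine ⟨delAdd G' v x c hxc hxV hcV hxv hcv,
    TT_delAdd G' hG' v x c hxc hxV hcV hxv hcv hv hd hadj ?_,
    le_delAdd G G' hle v x c hxc hxV hcV hxv hcv hvG, card_del_lt _ _ v hv rfl,
    Or.inr (Or.inr (Or.inr ?_))⟩
  · intro T hx hc hvT hT
    by_cases ha : a ∈ T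
    · exact bad T ha hx hc hvT hT
    · exact bad (insert a T) (by simp) (by simp [hx]) (by simp [hc]) (by simp [hvT, hA.ne])
        (two_nbrs G' hG' T hT a x c ha hx hc hxc hxa.symm hac)
  · refine ⟨x, v, a, b, ⟨hxV, hxv⟩, fun h => h.2 rfl, hab.ne, Or.inl ⟨hxa, hxv, hA.ne.symm⟩,
      Or.inl ⟨hxb, hxv, hB.ne.symm⟩, fun w => if w = c then v else x, ?_, insert_del _ _ hv, ?_⟩
    · intro w
      by_cases h : w = c <;> simp [h]
    · intro p q
      have hp := hn p
      have hq := hn q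
      have hpq := G'.adj_comm p q
      have h1 := G'.adj_comm p v
      have h2 := G'.adj_comm q v
      have h3 := G'.adj_comm p x
      have h4 := G'.adj_comm q x
      have h5 := hac.ne
      have h6 := hbc.ne
      have h7 := hxa.ne
      have h8 := hxb.ne
      have h9 := hA.ne
      have h10 := hB.ne
      have hnp : ¬ G'.Adj p p := fun h => h.ne rfl
      simp only [delAdd]
      constructor
      · intro h
        by_cases e1 : p = v
        · subst e1
          grind
        by_cases e2 : q = v
        · subst e2
          grind
        by_cases e3 : p = x
        · subst e3
          by_cases e4 : q = a ∨ q = b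
          · grind
          · exact Or.inr (Or.inr (Or.inr ⟨q, by grind⟩))
        by_cases e3 : q = x
        · subst e3
          by_cases e4 : p = a ∨ p = b
          · grind
          · exact Or.inr (Or.inr (Or.inr ⟨p, by grind⟩))
        grind
      · rintro (h | h | h | ⟨w, h1, h2, h3, h4⟩)
        · grind
        · grind
        · grind
        · have hvw := hn w
          have hw := G'.adj_comm x w
          have hvw' := G'.adj_comm v w
          by_cases hwc : w = c
          · simp only [hwc, if_true] at h4
            grind
          · simp only [hwc, if_false] at h4
            grind

theorem step_K4 {V : Type} [Fintype V] (G G' : (⊤ : SimpleGraph V).Subgraph) (hle : G ≤ G')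
    (hG' : TT G') (w0 w1 w2 w3 : V)
    (h01 : G'.Adj w0 w1) (h02 : G'.Adj w0 w2) (h03 : G'.Adj w0 w3)
    (h12 : G'.Adj w1 w2) (h13 : G'.Adj w1 w3) (h23 : G'.Adj w2 w3)
    (hw1 : w1 ∉ G.verts) (hw2 : w2 ∉ G.verts) (hw3 : w3 ∉ G.verts)
    (huniq : ∀ x ∉ ({w0, w1, w2, w3} : Finset V), ∀ k ∈ ({w0, w1, w2, w3} : Finset V),
      ∀ l ∈ ({w0, w1, w2, w3} : Finset V), G'.Adj x k → G'.Adj x l → k = l) :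
    Step G G' := by
  have e01 := h01.ne
  have e02 := h02.ne
  have e03 := h03.ne
  have e12 := h12.ne
  have e13 := h13.ne
  have e23 := h23.ne
  have v0 := G'.edge_vert h01
  have v1 := G'.edge_vert h01.symm
  have v2 := G'.edge_vert h02.symm
  have v3 := G'.edge_vert h03.symm
  have hQ := K4_tight G' w0 w1 w2 w3 h01 h02 h03 h12 h13 h23
  have hmem : ∀ x, x ∈ ({w0, w1, w2, w3} : Finset V) ↔ (x = w0 ∨ x = w1 ∨ x = w2 ∨ x = w3) := by
    simp
  have hGQ : ∀ x ∈ G.verts, x ∈ ({w0, w1, w2, w3} : Finset V) → x = w0 := by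
    intro x hx
    rw [hmem]
    rintro (rfl | rfl | rfl | rfl)
    · rfl
    · exact absurd hx hw1
    · exact absurd hx hw2
    · exact absurd hx hw3
  have hw : w0 ∈ ({w0, w1, w2, w3} : Finset V) := by simp
  refine ⟨contr G' {w0, w1, w2, w3} w0 hw v0,
    TT_contr G' hG' _ _ _ _ ?_ hQ huniq, ⟨?_, ?_⟩, ?_, Or.inr (Or.inr (Or.inl ?_))⟩
  · intro q
    rw [hmem]
    rintro (rfl | rfl | rfl | rfl) <;> assumption
  · intro a ha
    have := hGQ a ha
    exact ⟨hle.1 ha, by tauto⟩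
  · intro a b hab
    have ha := hGQ a (G.edge_vert hab)
    have hb := hGQ b (G.edge_vert hab.symm)
    have hab' := hle.2 hab
    have hne := hab.ne
    by_cases ha' : a ∈ ({w0, w1, w2, w3} : Finset V)
    · by_cases hb' : b ∈ ({w0, w1, w2, w3} : Finset V)
      · exact absurd ((ha ha').trans (hb hb').symm) hne
      · exact Or.inr (Or.inl ⟨ha ha', hb', a, ha', hab'⟩)
    · by_cases hb' : b ∈ ({w0, w1, w2, w3} : Finset V)
      · exact Or.inr (Or.inr ⟨hb hb', ha', b, hb', hab'.symm⟩)
      · exact Or.inl ⟨hab', ha', hb'⟩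
  · apply Finset.card_lt_card
    rw [Finset.ssubset_iff_of_subset]
    · refine ⟨w1, (mem_vf _ _).2 v1, ?_⟩
      rw [mem_vf]
      rintro ⟨_, h | h⟩
      · exact h (by simp)
      · exact e01 h.symm
    · intro a ha
      rw [mem_vf] at *
      exact ha.1
  · refine ⟨w0, w1, w2, w3, ⟨v0, Or.inr rfl⟩, ?_, ?_, ?_, e12, e13, e23,
      fun x => if G'.Adj x w1 then w1 else if G'.Adj x w2 then w2 else
        if G'.Adj x w3 then w3 else w0, ?_, ?_, ?_⟩
    · rintro ⟨_, h | h⟩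
      · exact h (by simp)
      · exact e01 h.symm
    · rintro ⟨_, h | h⟩
      · exact h (by simp)
      · exact e02 h.symm
    · rintro ⟨_, h | h⟩
      · exact h (by simp)
      · exact e03 h.symm
    · intro x
      dsimp only
      split_ifs <;> simp
    · ext a
      simp only [contr, Set.mem_insert_iff, Set.mem_ofPred_eq, hmem]
      constructor
      · tauto
      · rintro (rfl | rfl | rfl | h)
        · exact v1
        · exact v2
        · exact v3
        · exact h.1
    · have hf : ∀ x ∉ ({w0, w1, w2, w3} : Finset V), ∀ k ∈ ({w0, w1, w2, w3} : Finset V),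
          G'.Adj x k → (if G'.Adj x w1 then w1 else if G'.Adj x w2 then w2 else
            if G'.Adj x w3 then w3 else w0) = k := by
        intro x hx k hk hxk
        split_ifs with i1 i2 i3
        · exact huniq x hx _ (by simp) k hk i1 hxk
        · exact huniq x hx _ (by simp) k hk i2 hxk
        · exact huniq x hx _ (by simp) k hk i3 hxk
        · rw [hmem] at hk
          rcases hk with rfl | rfl | rfl | rfl
          · rfl
          · exact absurd hxk i1
          · exact absurd hxk i2
          · exact absurd hxk i3
      have hset : ({w0, w1, w2, w3} : Set V) = {x | x ∈ ({w0, w1, w2, w3} : Finset V)} := by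
        ext; simp
      have hadjQ : ∀ k ∈ ({w0, w1, w2, w3} : Finset V), ∀ l ∈ ({w0, w1, w2, w3} : Finset V),
          k ≠ l → G'.Adj k l := by
        have h1 := h01.symm
        have h2 := h02.symm
        have h3 := h03.symm
        have h4 := h12.symm
        have h5 := h13.symm
        have h6 := h23.symm
        intro k hk l hl hkl
        rw [hmem] at hk hl
        rcases hk with rfl | rfl | rfl | rfl <;> rcases hl with rfl | rfl | rfl | rfl <;>
          first | assumption | exact absurd rfl hkl
      rw [hset]
      generalize hQdef : ({w0, w1, w2, w3} : Finset V) = Q at *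
      generalize hfdef : (fun x => (if G'.Adj x w1 then w1 else if G'.Adj x w2 then w2 else
            if G'.Adj x w3 then w3 else w0)) = f at *
      have hf' : ∀ x ∉ Q, ∀ k ∈ Q, G'.Adj x k → f x = k := by
        intro x hx k hk hxk
        rw [← hf x hx k hk hxk, ← hfdef]
      intro a b
      simp only [contr, Set.mem_ofPred_eq]
      constructor
      · intro h
        by_cases ha : a ∈ Q
        · by_cases hb : b ∈ Q
          · exact Or.inr (Or.inr ⟨ha, hb, h.ne⟩)
          · exact Or.inr (Or.inl ⟨b, Or.inr (Or.inr ⟨trivial, hb, a, ha, h⟩),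
              Or.inr ⟨rfl, (hf' b hb a ha h.symm).symm⟩⟩)
        · by_cases hb : b ∈ Q
          · exact Or.inr (Or.inl ⟨a, Or.inr (Or.inr ⟨trivial, ha, b, hb, h.symm⟩),
              Or.inl ⟨rfl, (hf' a ha b hb h).symm⟩⟩)
          · exact Or.inl ⟨Or.inl ⟨h, ha, hb⟩, fun e => ha (e ▸ hw), fun e => hb (e ▸ hw)⟩
      · rintro (⟨h | h | h, ha, hb⟩ | ⟨x, hx, h⟩ | ⟨ha, hb, hne⟩)
        · exact h.1
        · exact absurd h.1 ha
        · exact absurd h.1 hb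
        · have hx' : x ∉ Q ∧ ∃ k ∈ Q, G'.Adj k x := by
            rcases hx with hx | hx | hx
            · exact absurd hw hx.2.2
            · exact absurd hw hx.2.1
            · exact hx.2
          obtain ⟨hxQ, k, hk, hkx⟩ := hx'
          have := hf' x hxQ k hk hkx.symm
          rcases h with ⟨rfl, rfl⟩ | ⟨rfl, rfl⟩
          · rw [this]; exact hkx.symm
          · rw [this]; exact hkx
        · exact hadjQ a ha b hb hne

theorem step_main {V : Type} [Fintype V] (G G' : (⊤ : SimpleGraph V).Subgraph) (hle : G ≤ G')
    (hG : TT G) (hG' : TT G') (hne : G ≠ G') : Step G G' := by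
  obtain ⟨v, hv, hvG, hd | hd⟩ := exists_low G G' hle hG hG' hne
  · exact step_two G G' hle hG' v hv hvG hd
  have hd' := hd
  rw [nn_single, Finset.card_eq_three] at hd'
  obtain ⟨a, b, c, hab, hac, hbc, h⟩ := hd'
  have hn : ∀ w, G'.Adj v w ↔ (w = a ∨ w = b ∨ w = c) := by
    intro w
    have := Finset.ext_iff.1 h w
    simp only [Finset.mem_filter, mem_vf, Finset.mem_insert, Finset.mem_singleton] at this
    rw [← this]
    exact ⟨fun h => ⟨G'.edge_vert h.symm, h⟩, fun h => h.2⟩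
  have hA : G'.Adj v a := (hn a).2 (by simp)
  have hB : G'.Adj v b := (hn b).2 (by simp)
  have hC : G'.Adj v c := (hn c).2 (by simp)
  by_cases iab : G'.Adj a b
  swap
  · exact step_three G G' hle hG' v hv hvG hd a b c hab hac hbc hn iab
  by_cases iac : G'.Adj a c
  swap
  · exact step_three G G' hle hG' v hv hvG hd a c b hac hab hbc.symm
      (fun w => by rw [hn]; tauto) iac
  by_cases ibc : G'.Adj b c
  swap
  · exact step_three G G' hle hG' v hv hvG hd b c a hbc hab.symm hac.symm
      (fun w => by rw [hn]; tauto) ibc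
  by_cases hx : ∃ x, x ≠ v ∧ x ≠ a ∧ x ≠ b ∧ x ≠ c ∧
      ((G'.Adj x a ∧ G'.Adj x b) ∨ (G'.Adj x a ∧ G'.Adj x c) ∨ (G'.Adj x b ∧ G'.Adj x c))
  · obtain ⟨x, xv, xa, xb, xc, h | h | h⟩ := hx
    · exact step_cycle G G' hle hG' v hv hvG hd a b c x iab iac ibc hn xv xc h.1 h.2
    · exact step_cycle G G' hle hG' v hv hvG hd a c b x iac iab ibc.symm
        (fun w => by rw [hn]; tauto) xv xb h.1 h.2
    · exact step_cycle G G' hle hG' v hv hvG hd b c a x ibc iab.symm iac.symm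
        (fun w => by rw [hn]; tauto) xv xa h.1 h.2
  have huniq : ∀ x ∉ ({a, b, c, v} : Finset V), ∀ k ∈ ({a, b, c, v} : Finset V),
      ∀ l ∈ ({a, b, c, v} : Finset V), G'.Adj x k → G'.Adj x l → k = l := by
    intro x hxQ k hk l hl hxk hxl
    have h1 := G'.adj_comm x v
    have h2 := hn x
    simp only [Finset.mem_insert, Finset.mem_singleton, not_or] at hxQ hk hl
    by_contra hkl
    apply hx
    refine ⟨x, hxQ.2.2.2, hxQ.1, hxQ.2.1, hxQ.2.2.1, ?_⟩
    have hxv : ¬ G'.Adj x v := by tauto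
    rcases hk with rfl | rfl | rfl | rfl <;> rcases hl with rfl | rfl | rfl | rfl <;> tauto
  have hT := sub_tight G G' hle hG hG'
  have hvT : v ∉ vf G := fun h => hvG ((mem_vf _ _).1 h)
  have key : ∀ a b c, G'.Adj v a → G'.Adj v b → G'.Adj v c → G'.Adj a b → G'.Adj a c →
      G'.Adj b c → a ∈ G.verts → b ∉ G.verts := by
    intro a b c hA hB hC iab iac ibc ha hb
    rw [← mem_vf] at ha hb
    by_cases hc : c ∈ vf G
    · exact three_nbrs G' hG' _ hT v a b c hvT ha hb hc iab.ne iac.ne ibc.ne hA hB hC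
    · have h2 := two_nbrs G' hG' _ hT c a b hc ha hb iab.ne iac.symm ibc.symm
      exact three_nbrs G' hG' _ h2 v a b c (by simp [hvT, hC.ne]) (by simp [ha]) (by simp [hb])
        (by simp) iab.ne iac.ne ibc.ne hA hB hC
  have kab := key a b c hA hB hC iab iac ibc
  have kac := key a c b hA hC hB iac iab ibc.symm
  have kbc := key b c a hB hC hA ibc iab.symm iac.symm
  by_cases ha : a ∈ G.verts
  · exact step_K4 G G' hle hG' a b c v iab iac hA.symm ibc hB.symm hC.symm (kab ha) (kac ha) hvG
      huniq
  by_cases hb : b ∈ G.verts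
  · have e : ({b, a, c, v} : Finset V) = {a, b, c, v} := Finset.insert_comm _ _ _
    exact step_K4 G G' hle hG' b a c v iab.symm ibc hB.symm iac hA.symm hC.symm ha (kbc hb) hvG
      (by rw [e]; exact huniq)
  · have e : ({c, a, b, v} : Finset V) = {a, b, c, v} := by
      rw [Finset.insert_comm c a, Finset.insert_comm c b]
    exact step_K4 G G' hle hG' c a b v iac.symm ibc.symm hC.symm iab hA.symm hB.symm ha hb hvG
      (by rw [e]; exact huniq)

theorem chain_main {V : Type} [Fintype V] (G : (⊤ : SimpleGraph V).Subgraph) (hG : TT G) (m : ℕ) :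
    ∀ G' : (⊤ : SimpleGraph V).Subgraph, G ≤ G' → TT G' → (vf G').card ≤ m →
    ∃ (n : ℕ) (c : ℕ → (⊤ : SimpleGraph V).Subgraph),
      c 0 = G ∧ c n = G' ∧
      ∀ i < n, HennVertexMove (c i) (c (i + 1)) ∨ HennEdgeMove (c i) (c (i + 1)) ∨
        VertexToK4Move (c i) (c (i + 1)) ∨ VertexTo4CycleMove (c i) (c (i + 1)) := by
  induction m with
  | zero =>
    intro G' _ h2 h3
    have := h2.2
    omega
  | succ m ih =>
    intro G' hle hG' hm
    by_cases hne : G = G'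
    · exact ⟨0, fun _ => G, rfl, hne, fun i hi => absurd hi (Nat.not_lt_zero i)⟩
    obtain ⟨K, hK, hGK, hc, hmove⟩ := step_main G G' hle hG hG' hne
    obtain ⟨n, c, h0, hn, hs⟩ := ih K hGK hK (by omega)
    refine ⟨n + 1, fun i => if i ≤ n then c i else G', by simpa using h0, by simp, ?_⟩
    intro i hi
    rcases Nat.lt_or_ge i n with h | h
    · have h1 : i ≤ n := h.le
      have h2 : i + 1 ≤ n := h
      simp only [h1, h2, if_true]
      exact hs i h
    · have h1 : i = n := by omega
      subst h1
      simp only [le_refl, if_true, hn]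
      simpa using hmove

theorem statement_11 {V : Type} [Fintype V]
    (G G' : (⊤ : SimpleGraph V).Subgraph) (hGG' : G ≤ G')
    (hG : SubTight 2 2 G) (hG' : SubTight 2 2 G') :
    ∃ (n : ℕ) (c : ℕ → (⊤ : SimpleGraph V).Subgraph),
      c 0 = G ∧ c n = G' ∧
      ∀ i < n, HennVertexMove (c i) (c (i + 1)) ∨ HennEdgeMove (c i) (c (i + 1)) ∨
        VertexToK4Move (c i) (c (i + 1)) ∨ VertexTo4CycleMove (c i) (c (i + 1)) := by
  exact chain_main G (TT_of_tight G hG) _ G' hGG' (TT_of_tight G' hG') le_rfl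

end RigidityPaper
end
end

section
/- Let (G,p) be a bar-joint framework in (ℝ^d,‖·‖_q) where q ∈ (1,∞). Then a map u : V(G) → ℝ^d is an infinitesimal flex of (G,p) if and only if for every edge vw ∈ E(G), Σ_{i=1}^d sgn(p_{v,i} − p_{w,i}) · |p_{v,i} − p_{w,i}|^{q−1} · (u_{v,i} − u_{w,i}) = 0. -/
open Asymptotics Filter Topology Set

open scoped Classical

noncomputable section

namespace RigidityPaper

variable {V X E : Type}

variable {G : SimpleGraph V}

theorem aux_coef (q x : ℝ) : q * |x| ^ (q - 2) * x = q * (Real.sign x * |x| ^ (q - 1)) := by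
  rcases eq_or_ne x 0 with rfl | hx
  · simp
  · have h : |x| ^ (q - 1) = |x| ^ (q - 2) * |x| := by
      rw [← Real.rpow_add_one (abs_ne_zero.mpr hx)]
      congr 1
      ring
    have h2 : Real.sign x * |x| = x := by
      rcases lt_or_gt_of_ne hx with h | h
      · rw [Real.sign_of_neg h, abs_of_neg h]; ring
      · rw [Real.sign_of_pos h, abs_of_pos h]; ring
    rw [h]
    linear_combination (-q * |x| ^ (q - 2)) * h2

theorem aux_pos {q : ℝ} {d : ℕ} (x : Fin d → ℝ) (hx : x ≠ 0) : 0 < ∑ i, |x i| ^ q := by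
  obtain ⟨j, hj⟩ := Function.ne_iff.mp hx
  refine Finset.sum_pos' (fun i _ => by positivity) ⟨j, Finset.mem_univ j, ?_⟩
  exact Real.rpow_pos_of_pos (abs_pos.mpr hj) q

theorem aux_deriv {q : ℝ} (hq : 1 < q) {d : ℕ} (x y : Fin d → ℝ) (hx : x ≠ 0) :
    HasDerivAt (fun t : ℝ => qnorm q (x + t • y))
      ((∑ i, Real.sign (x i) * |x i| ^ (q - 1) * y i) * (∑ i, |x i| ^ q) ^ (1 / q - 1)) 0 := by
  have h1 : HasDerivAt (fun t : ℝ => ∑ i, |x i + t * y i| ^ q)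
      (∑ i, q * (Real.sign (x i) * |x i| ^ (q - 1)) * y i) 0 := by
    refine HasDerivAt.fun_sum fun i _ => ?_
    have h2 : HasDerivAt (fun t : ℝ => x i + t * y i) (y i) 0 := by
      simpa using ((hasDerivAt_id (0 : ℝ)).mul_const (y i)).const_add (x i)
    have h3 := hasDerivAt_abs_rpow (x i + 0 * y i) hq
    have h4 := HasDerivAt.comp (0 : ℝ) h3 h2
    rw [aux_coef] at h4
    simpa [Function.comp_def] using h4
  have hF := aux_pos (q := q) x hx
  have h5 := h1.rpow_const (p := 1 / q) (Or.inl (by simpa using hF.ne'))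
  have hq0 : q ≠ 0 := by positivity
  have h6 : (∑ i, Real.sign (x i) * |x i| ^ (q - 1) * y i) * (∑ i, |x i| ^ q) ^ (1 / q - 1) =
      (∑ i, q * (Real.sign (x i) * |x i| ^ (q - 1)) * y i) * (1 / q) *
        (∑ i, |x i + 0 * y i| ^ q) ^ (1 / q - 1) := by
    simp only [zero_mul, add_zero, mul_assoc, ← Finset.mul_sum]
    rw [mul_left_comm, ← mul_assoc q, mul_one_div_cancel hq0, one_mul]
  rw [h6]
  exact h5

theorem statement_12 {V : Type} (G : SimpleGraph V) {d : ℕ} {q : ℝ} (hq : 1 < q)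
    (p : V → Fin d → ℝ) (hp : IsPlacement G p) (u : V → Fin d → ℝ) :
    IsQFlex q G p u ↔
      ∀ ⦃v w⦄, G.Adj v w →
        ∑ i, Real.sign (p v i - p w i) * |p v i - p w i| ^ (q - 1) * (u v i - u w i) = 0 := by
  unfold IsQFlex
  refine forall_congr' fun v => forall_congr' fun w => forall_congr' fun hvw => ?_
  have hx : p v - p w ≠ 0 := sub_ne_zero.mpr (hp hvw)
  have hd := aux_deriv hq (p v - p w) (u v - u w) hx
  have hF := Real.rpow_pos_of_pos (aux_pos (q := q) _ hx) (1 / q - 1)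
  have key : (fun t : ℝ => qnorm q ((p v + t • u v) - (p w + t • u w)) - qnorm q (p v - p w))
      =o[𝓝 (0 : ℝ)] (fun t : ℝ => t) ↔
      HasDerivAt (fun t : ℝ => qnorm q ((p v - p w) + t • (u v - u w))) 0 0 := by
    have h : ∀ t : ℝ, (p v + t • u v) - (p w + t • u w) = (p v - p w) + t • (u v - u w) := by
      intro t; rw [smul_sub]; abel
    simp [hasDerivAt_iff_isLittleO, h]
  rw [key]
  constructor
  · intro h
    have := hd.unique h
    rcases mul_eq_zero.mp this with h0 | h0
    · simpa using h0
    · exact absurd h0 hF.ne'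
  · intro h
    have h' : ∑ i, Real.sign ((p v - p w) i) * |(p v - p w) i| ^ (q - 1) * (u v - u w) i = 0 := by
      simpa using h
    rw [h', zero_mul] at hd
    exact hd

end RigidityPaper
end
end

section
/- Let G be a finite (k,l)-sparse loopless multigraph and let H₁ and H₂ be subgraphs of G, both of which are (k,l)-tight. Suppose that either (a) k = 2, l = 3 and H₁ ∩ H₂ has at least two vertices, or (b) k = l ≥ 1 and H₁ ∩ H₂ has at least one vertex. Then H₁ ∪ H₂ and H₁ ∩ H₂ are (k,l)-tight. -/
open Asymptotics Filter Topology Set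

open scoped Classical

noncomputable section

namespace RigidityPaper

variable {V X E : Type}

variable {G : SimpleGraph V}

theorem statement_13 {V E : Type} [Fintype V] [Fintype E] (k l : ℕ) (hk : 1 ≤ k) (hl : 1 ≤ l)
    (ends : E → Sym2 V) (hloop : ∀ e, ¬ (ends e).IsDiag)
    (hsparse : MGSparseOn k l ends univ univ)
    (V₁ V₂ : Set V) (E₁ E₂ : Set E)
    (h₁ : MGSubgraph ends V₁ E₁) (h₂ : MGSubgraph ends V₂ E₂)
    (ht₁ : MGTightOn k l ends V₁ E₁) (ht₂ : MGTightOn k l ends V₂ E₂)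
    (hcase : (k = 2 ∧ l = 3 ∧ 2 ≤ (V₁ ∩ V₂).ncard) ∨ (k = l ∧ (V₁ ∩ V₂).Nonempty)) :
    MGTightOn k l ends (V₁ ∪ V₂) (E₁ ∪ E₂) ∧ MGTightOn k l ends (V₁ ∩ V₂) (E₁ ∩ E₂) := by
  have hmono : ∀ (A : Set V) (B : Set E), MGSparseOn k l ends A B :=
    fun A B V'' E'' _ _ hs h2 => hsparse V'' E'' (subset_univ _) (subset_univ _) hs h2
  have key : ∀ (A : Set V) (B : Set E), V₁ ∩ V₂ ⊆ A → MGSubgraph ends A B →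
      (B.ncard : ℤ) ≤ (k * A.ncard : ℤ) - l := by
    intro A B hA hs
    have hle : (V₁ ∩ V₂).ncard ≤ A.ncard := ncard_le_ncard hA (toFinite _)
    by_cases h2 : 2 ≤ A.ncard
    · exact hmono A B A B le_rfl le_rfl hs h2
    rcases hcase with ⟨_, _, h⟩ | ⟨hkl, hne⟩
    · omega
    have hpos : 0 < (V₁ ∩ V₂).ncard := (ncard_pos (toFinite _)).2 hne
    have h1 : A.ncard = 1 := by omega
    obtain ⟨a, rfl⟩ := ncard_eq_one.1 h1
    have hB : B = ∅ := by
      rw [eq_empty_iff_forall_notMem]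
      intro e he
      have h := hs e he
      have hd := hloop e
      revert h hd
      induction ends e using Sym2.ind with
      | _ x y =>
        intro h hd
        have hx : x = a := h x (by simp)
        have hy : y = a := h y (by simp)
        exact hd (by simp [hx, hy])
    subst hB
    simp [hkl]
  have hu := key (V₁ ∪ V₂) (E₁ ∪ E₂) (fun x hx => Or.inl hx.1) (by
    rintro e (he | he) v hv
    · exact Or.inl (h₁ e he v hv)
    · exact Or.inr (h₂ e he v hv))
  have hi := key (V₁ ∩ V₂) (E₁ ∩ E₂) le_rfl
    (fun e he v hv => ⟨h₁ e he.1 v hv, h₂ e he.2 v hv⟩)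
  have hV := ncard_union_add_ncard_inter V₁ V₂ (toFinite _) (toFinite _)
  have hE := ncard_union_add_ncard_inter E₁ E₂ (toFinite _) (toFinite _)
  have e1 := ht₁.2
  have e2 := ht₂.2
  have hV' : (k : ℤ) * (V₁ ∪ V₂).ncard + k * (V₁ ∩ V₂).ncard = k * V₁.ncard + k * V₂.ncard := by
    rw [← mul_add, ← mul_add]; exact_mod_cast congrArg (k * ·) hV
  exact ⟨⟨hmono _ _, by omega⟩, ⟨hmono _ _, by omega⟩⟩

end RigidityPaper
end
end
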